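/- arXiv:2605.19599 — 2 statements merged into one kernel-verified Lean document; each statement's English description precedes it below -/
import Mathlib

section
/- Let N ≥ 2 be an integer, α ∈ (0,1) and M > 0. Let Ω ⊆ ℝ^N be a bounded open set contained in {x : 0 < x_N < M}. Then for every smooth function u : ℝ^N → ℝ with compact support contained in Ω, one has ∫_Ω u(x)² dx ≤ (4 M^{2−α}/(1−α)²) ∫_Ω x_N^α (∂u/∂x_N)(x)² dx; in particular ∫_Ω u² dx ≤ (4 M^{2−α}/(1−α)²) ∫_Ω ∇u·A∇u dx. -/
open MeasureTheory Set Filter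

/-- Partial derivative of `u` in the `i`-th coordinate direction. -/
noncomputable def pd {N : ℕ} (i : Fin N) (u : (Fin N → ℝ) → ℝ) (x : Fin N → ℝ) : ℝ :=
  fderiv ℝ u x (Pi.single i 1)

section WeightedHardy

variable {N : ℕ} {n : Fin N}

theorem continuous_pd {u : (Fin N → ℝ) → ℝ} (hu : ContDiff ℝ 1 u) (i : Fin N) :
    Continuous (pd i u) :=
  (hu.continuous_fderiv one_ne_zero).clm_apply continuous_const

theorem tsupport_pd_subset (u : (Fin N → ℝ) → ℝ) (i : Fin N) :
    tsupport (pd i u) ⊆ tsupport u :=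
  tsupport_fderiv_apply_subset ℝ (Pi.single i 1)

/-- A power of a coordinate is integrable against a continuous compactly supported function whose
support avoids the zero set of that coordinate. -/
theorem integrable_coord_rpow_mul {g : (Fin N → ℝ) → ℝ} {K : Set (Fin N → ℝ)}
    (hg : Continuous g) (hK : IsCompact K) (hgK : tsupport g ⊆ K) (hpos : ∀ x ∈ K, 0 < x n)
    (β : ℝ) : Integrable (fun x => x n ^ β * g x) := by
  have hsub : tsupport (fun x => x n ^ β * g x) ⊆ tsupport g := tsupport_mul_subset_right
  refine Continuous.integrable_of_hasCompactSupport ?_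
    (hK.of_isClosed_subset (isClosed_tsupport _) (hsub.trans hgK))
  refine continuous_of_tsupport fun x hx => ?_
  have hcoord : ContinuousAt (fun x : Fin N → ℝ => x n) x := (continuous_apply n).continuousAt
  exact (hcoord.rpow_const (Or.inl (hpos x (hgK (hsub hx))).ne')).mul hg.continuousAt

theorem tsupport_sq_subset (g : (Fin N → ℝ) → ℝ) : tsupport (fun x => g x ^ 2) ⊆ tsupport g :=
  tsupport_comp_subset (g := fun t : ℝ => t ^ 2) (by simp) g

theorem integrable_coord_rpow_mul_sq {g : (Fin N → ℝ) → ℝ} {K : Set (Fin N → ℝ)}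
    (hg : Continuous g) (hK : IsCompact K) (hgK : tsupport g ⊆ K) (hpos : ∀ x ∈ K, 0 < x n)
    (β : ℝ) : Integrable (fun x => x n ^ β * g x ^ 2) :=
  integrable_coord_rpow_mul (g := fun x => g x ^ 2) (by fun_prop) hK
    ((tsupport_sq_subset g).trans hgK) hpos β

theorem hasLineDerivAt_coord_rpow {x : Fin N → ℝ} (hx : 0 < x n) (β : ℝ) :
    HasLineDerivAt ℝ (fun x : Fin N → ℝ => x n ^ β) (β * x n ^ (β - 1)) x (Pi.single n 1) := by
  have h := ((hasFDerivAt_apply (𝕜 := ℝ) n x).rpow_const (p := β)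
    (Or.inl hx.ne')).hasLineDerivAt (Pi.single n 1)
  simpa using h

/-- The one-dimensional Hardy inequality with weight `t ^ α`, integrated along the `n`-th
coordinate direction. -/
theorem weighted_hardy {u : (Fin N → ℝ) → ℝ} (hu : ContDiff ℝ 1 u) (hcs : HasCompactSupport u)
    (hpos : ∀ x ∈ tsupport u, 0 < x n) (α : ℝ) :
    ((1 - α) / 2) ^ 2 * ∫ x, x n ^ (α - 2) * u x ^ 2 ≤ ∫ x, x n ^ α * pd n u x ^ 2 := by
  have hu_int : Integrable fun x => x n ^ (α - 2) * u x ^ 2 :=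
    integrable_coord_rpow_mul_sq hu.continuous hcs subset_rfl hpos _
  have hu_int' : Integrable fun x => x n ^ (α - 1) * u x ^ 2 :=
    integrable_coord_rpow_mul_sq hu.continuous hcs subset_rfl hpos _
  have hmix_int : Integrable fun x => x n ^ (α - 1) * (2 * u x * pd n u x) :=
    integrable_coord_rpow_mul ((continuous_const.mul hu.continuous).mul (continuous_pd hu n)) hcs
      (tsupport_mul_subset_right.trans (tsupport_pd_subset u n)) hpos _
  have hpd_int : Integrable fun x => x n ^ α * pd n u x ^ 2 :=
    integrable_coord_rpow_mul_sq (continuous_pd hu n) hcs (tsupport_pd_subset u n) hpos _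
  have hparts : ∫ x, x n ^ (α - 1) * (2 * u x * pd n u x)
      = (1 - α) * ∫ x, x n ^ (α - 2) * u x ^ 2 := by
    have h := integral_bilinear_hasLineDerivAt_right_eq_neg_left_of_integrable
      (μ := (volume : Measure (Fin N → ℝ))) (v := Pi.single n 1)
      (f := fun x : Fin N → ℝ => x n ^ (α - 1))
      (f' := fun x => (α - 1) * x n ^ (α - 2)) (g := fun x => u x ^ 2)
      (g' := fun x => 2 * u x * pd n u x) (B := ContinuousLinearMap.mul ℝ ℝ)
      (by simpa [mul_assoc] using hu_int.const_mul (α - 1)) (by simpa using hmix_int)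
      (by simpa using hu_int')
      (fun x hx => by
        have h := hasLineDerivAt_coord_rpow (hpos x (tsupport_sq_subset u hx)) (α - 1)
        rwa [show α - 1 - 1 = α - 2 by ring] at h)
      (fun x _ => by
        have h := (((hu.differentiable one_ne_zero).differentiableAt
          (x := x)).hasFDerivAt.pow 2).hasLineDerivAt (Pi.single n 1)
        simpa [pd, mul_assoc] using h)
    simp only [ContinuousLinearMap.mul_apply', mul_assoc, integral_const_mul] at h
    simp only [mul_assoc]
    rw [h]
    ring
  set c := (1 - α) / 2 with hc
  have hle : ∫ x, (c * (x n ^ (α - 1) * (2 * u x * pd n u x))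
      - c ^ 2 * (x n ^ (α - 2) * u x ^ 2)) ≤ ∫ x, x n ^ α * pd n u x ^ 2 := by
    refine integral_mono ((hmix_int.const_mul c).sub (hu_int.const_mul (c ^ 2))) hpd_int
      fun x => ?_
    by_cases hx : x ∈ tsupport u
    · have hx0 := hpos x hx
      have h1 : x n ^ (α - 1) = x n ^ (α - 2) * x n := by
        rw [← Real.rpow_add_one hx0.ne']; ring_nf
      have h2 : x n ^ α = x n ^ (α - 2) * x n ^ 2 := by
        rw [← Real.rpow_add_natCast hx0.ne']; norm_num
      have h3 : 0 ≤ x n ^ (α - 2) * (x n * pd n u x - c * u x) ^ 2 := by positivity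
      simp only [h1, h2]
      nlinarith [h3]
    · have hpd : pd n u x = 0 :=
        image_eq_zero_of_notMem_tsupport fun h => hx (tsupport_pd_subset u n h)
      simp [image_eq_zero_of_notMem_tsupport hx, hpd]
  rw [integral_sub (hmix_int.const_mul c) (hu_int.const_mul _), integral_const_mul,
    integral_const_mul, hparts] at hle
  refine le_of_eq_of_le ?_ hle
  rw [hc]
  ring

end WeightedHardy

/-- The weighted Poincaré inequality of Corollary 2.1 (i). -/
theorem weighted_poincare (N : ℕ) (hN : 2 ≤ N) (n : Fin N) (hn : (n : ℕ) = N - 1)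
    (α M : ℝ) (hα : α ∈ Ioo (0 : ℝ) 1) (hM : 0 < M)
    (Ω : Set (Fin N → ℝ)) (hΩo : IsOpen Ω) (hΩb : Bornology.IsBounded Ω)
    (hΩs : Ω ⊆ {x | 0 < x n ∧ x n < M})
    (u : (Fin N → ℝ) → ℝ) (hu : ContDiff ℝ (⊤ : ℕ∞) u) (hcs : HasCompactSupport u)
    (hsupp : tsupport u ⊆ Ω) :
    (∫ x in Ω, (u x) ^ 2
      ≤ (4 * M ^ (2 - α) / (1 - α) ^ 2) * ∫ x in Ω, x n ^ α * (pd n u x) ^ 2) ∧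
    (∫ x in Ω, (u x) ^ 2
      ≤ (4 * M ^ (2 - α) / (1 - α) ^ 2) *
        ∫ x in Ω, ((∑ i ∈ Finset.univ.erase n, (pd i u x) ^ 2)
          + x n ^ α * (pd n u x) ^ 2)) := by
  have hu1 : ContDiff ℝ 1 u := hu.of_le (by exact_mod_cast le_top)
  have hpos : ∀ x ∈ tsupport u, 0 < x n := fun x hx => (hΩs (hsupp hx)).1
  have hpd_int (i : Fin N) (β : ℝ) : Integrable fun x => x n ^ β * pd i u x ^ 2 :=
    integrable_coord_rpow_mul_sq (continuous_pd hu1 i) hcs (tsupport_pd_subset u i) hpos β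
  have hu_int (β : ℝ) : Integrable fun x => x n ^ β * u x ^ 2 :=
    integrable_coord_rpow_mul_sq hu1.continuous hcs subset_rfl hpos β
  have hu_zero : ∀ x, x ∉ Ω → u x = 0 := fun x hx =>
    image_eq_zero_of_notMem_tsupport fun h => hx (hsupp h)
  have hpd_zero : ∀ x, x ∉ Ω → pd n u x = 0 := fun x hx =>
    image_eq_zero_of_notMem_tsupport fun h => hx (hsupp (tsupport_pd_subset u n h))
  have hα1 : 0 < 1 - α := sub_pos.2 hα.2
  have hfirst : ∫ x in Ω, (u x) ^ 2
      ≤ (4 * M ^ (2 - α) / (1 - α) ^ 2) * ∫ x in Ω, x n ^ α * (pd n u x) ^ 2 := by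
    rw [setIntegral_eq_integral_of_forall_compl_eq_zero fun x hx => by simp [hu_zero x hx],
      setIntegral_eq_integral_of_forall_compl_eq_zero fun x hx => by simp [hpd_zero x hx]]
    have hweight : ∫ x, u x ^ 2 ≤ M ^ (2 - α) * ∫ x, x n ^ (α - 2) * u x ^ 2 := by
      rw [← integral_const_mul]
      refine integral_mono (by simpa using hu_int 0) ((hu_int _).const_mul _) fun x => ?_
      by_cases hx : x ∈ Ω
      · have hx0 := (hΩs hx).1
        have hone : x n ^ (2 - α) * x n ^ (α - 2) = 1 := by
          rw [← Real.rpow_add hx0]; simp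
        have hle : x n ^ (2 - α) ≤ M ^ (2 - α) :=
          Real.rpow_le_rpow hx0.le (hΩs hx).2.le (by linarith)
        calc u x ^ 2 = x n ^ (2 - α) * (x n ^ (α - 2) * u x ^ 2) := by
              rw [← mul_assoc, hone, one_mul]
          _ ≤ M ^ (2 - α) * (x n ^ (α - 2) * u x ^ 2) := by gcongr
      · simp [hu_zero x hx]
    calc ∫ x, u x ^ 2 ≤ M ^ (2 - α) * ∫ x, x n ^ (α - 2) * u x ^ 2 := hweight
      _ = (4 * M ^ (2 - α) / (1 - α) ^ 2) *
          (((1 - α) / 2) ^ 2 * ∫ x, x n ^ (α - 2) * u x ^ 2) := by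
        field_simp
        ring
      _ ≤ _ := by
        gcongr
        exact weighted_hardy hu1 hcs hpos α
  refine ⟨hfirst, hfirst.trans ?_⟩
  refine mul_le_mul_of_nonneg_left ?_ (by positivity)
  refine integral_mono (hpd_int n α).integrableOn (Integrable.integrableOn ?_) fun x => ?_
  · exact (integrable_finsetSum _ fun i _ => by simpa using hpd_int i 0).add (hpd_int n α)
  · exact le_add_of_nonneg_left (Finset.sum_nonneg fun i _ => sq_nonneg _)
end

section
/- Let N ≥ 2, α ∈ (0,1), T > 0, γ ∈ ℝ, s > 0. Set Θ(t) = (t(T−t))^{−4} for t ∈ (0,T), ξ(x,t) = Θ(t)(γ − x_N^{2−α}), A(x) = diag(1,…,1,x_N^α). Let Ω ⊆ {x ∈ ℝ^N : x_N > 0} be a bounded open set, and let z be a smooth function on ℝ^N × ℝ with compact support contained in Ω × (0,T). Then ∫₀^T ∫_Ω (2s A∇z·∇ξ + s z div(A∇ξ)) · (s² z A∇ξ·∇ξ) dx dt = (2−α)⁴ s³ ∫₀^T ∫_Ω Θ(t)³ z² x_N^{2−α} dx dt. -/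
open MeasureTheory Set Filter

/-- The temporal Carleman weight `Θ(t) = (t(T-t))⁻⁴`. -/
noncomputable def Theta (T : ℝ) : ℝ → ℝ := fun t => (t * (T - t)) ^ (-4 : ℤ)

/-- The Carleman weight `ξ(x,t) = Θ(t)(γ - x_N^{2-α})`, with `n` the last coordinate index. -/
noncomputable def xi {N : ℕ} (n : Fin N) (α T γ : ℝ) (y : Fin N → ℝ) (τ : ℝ) : ℝ :=
  Theta T τ * (γ - y n ^ (2 - α))

/-- `A∇f·∇g = Σ_{i≠n} ∂_i f ∂_i g + x_N^α ∂_N f ∂_N g` for `A = diag(1,…,1,x_N^α)`. -/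
noncomputable def agrad {N : ℕ} (α : ℝ) (n : Fin N) (f g : (Fin N → ℝ) → ℝ)
    (x : Fin N → ℝ) : ℝ :=
  (∑ i ∈ Finset.univ.erase n, pd i f x * pd i g x) + x n ^ α * pd n f x * pd n g x

/-- `div(A∇f) = Σ_{i≠n} ∂²f/∂x_i² + ∂/∂x_N (x_N^α ∂f/∂x_N)` for `A = diag(1,…,1,x_N^α)`. -/
noncomputable def divA {N : ℕ} (α : ℝ) (n : Fin N) (f : (Fin N → ℝ) → ℝ)
    (x : Fin N → ℝ) : ℝ :=
  (∑ i ∈ Finset.univ.erase n, pd i (fun y => pd i f y) x) +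
    pd n (fun y => y n ^ α * pd n f y) x

lemma pd_comp_coord {N : ℕ} (i n : Fin N) {f : ℝ → ℝ} {f' : ℝ} {x : Fin N → ℝ}
    (hf : HasDerivAt f f' (x n)) :
    pd i (fun y => f (y n)) x = f' * (Pi.single i 1 : Fin N → ℝ) n := by
  have h := hf.comp_hasFDerivAt x (hasFDerivAt_apply (𝕜 := ℝ) (F' := fun _ : Fin N => ℝ) n x)
  have h' : HasFDerivAt (fun y : Fin N → ℝ => f (y n)) _ x := h
  simp [pd, h'.fderiv]

lemma pd_xi {N : ℕ} (i n : Fin N) {α : ℝ} (hα : α ≤ 1) (T γ t : ℝ) (x : Fin N → ℝ) :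
    pd i (fun y => xi n α T γ y t) x =
      -((2 - α) * Theta T t) * x n ^ (1 - α) * (Pi.single i 1 : Fin N → ℝ) n := by
  have h : HasDerivAt (fun r : ℝ => Theta T t * (γ - r ^ (2 - α)))
      (Theta T t * (-((2 - α) * x n ^ (2 - α - 1)))) (x n) :=
    ((Real.hasDerivAt_rpow_const (Or.inr (by linarith))).const_sub γ).const_mul _
  have h₁ := pd_comp_coord i n h
  unfold xi
  rw [h₁, show 2 - α - 1 = 1 - α by ring]
  ring

lemma agrad_xi_right {N : ℕ} (n : Fin N) {α : ℝ} (hα : α ≤ 1) (T γ t : ℝ)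
    (f : (Fin N → ℝ) → ℝ) {x : Fin N → ℝ} (hx : 0 < x n) :
    agrad α n f (fun y => xi n α T γ y t) x = -((2 - α) * Theta T t) * x n * pd n f x := by
  have h₀ : ∑ i ∈ Finset.univ.erase n, pd i f x * pd i (fun y => xi n α T γ y t) x = 0 := by
    refine Finset.sum_eq_zero fun i hi => ?_
    rw [pd_xi i n hα, Pi.single_eq_of_ne (Finset.ne_of_mem_erase hi).symm]
    simp
  have h₁ : x n ^ α * x n ^ (1 - α) = x n := by
    rw [← Real.rpow_add hx]; simp
  rw [agrad, h₀, pd_xi n n hα, Pi.single_eq_same]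
  linear_combination -((2 - α) * Theta T t) * pd n f x * h₁

lemma agrad_xi_xi {N : ℕ} (n : Fin N) {α : ℝ} (hα : α ≤ 1) (T γ t : ℝ)
    {x : Fin N → ℝ} (hx : 0 < x n) :
    agrad α n (fun y => xi n α T γ y t) (fun y => xi n α T γ y t) x =
      ((2 - α) * Theta T t) ^ 2 * x n ^ (2 - α) := by
  have h : x n ^ (2 - α) = x n * x n ^ (1 - α) := by
    rw [show 2 - α = 1 + (1 - α) by ring, Real.rpow_add hx, Real.rpow_one]
  rw [agrad_xi_right n hα T γ t _ hx, pd_xi n n hα, Pi.single_eq_same, h]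
  ring

lemma divA_xi {N : ℕ} (n : Fin N) {α : ℝ} (hα : α ≤ 1) (T γ t : ℝ)
    {x : Fin N → ℝ} (hx : 0 < x n) :
    divA α n (fun y => xi n α T γ y t) x = -((2 - α) * Theta T t) := by
  have h₀ : ∑ i ∈ Finset.univ.erase n,
      pd i (fun y => pd i (fun y => xi n α T γ y t) y) x = 0 := by
    refine Finset.sum_eq_zero fun i hi => ?_
    have h : (fun y => pd i (fun y => xi n α T γ y t) y) = fun _ => 0 := by
      funext y
      rw [pd_xi i n hα, Pi.single_eq_of_ne (Finset.ne_of_mem_erase hi).symm, mul_zero]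
    rw [h]
    simp [pd]
  have h₁ : (fun y : Fin N → ℝ => y n ^ α * pd n (fun y => xi n α T γ y t) y)
      =ᶠ[nhds x] fun y => -((2 - α) * Theta T t) * y n := by
    filter_upwards [(isOpen_lt continuous_const (continuous_apply n)).mem_nhds hx] with y hy
    have h : y n ^ α * y n ^ (1 - α) = y n := by
      rw [← Real.rpow_add hy]; simp
    rw [pd_xi n n hα, Pi.single_eq_same]
    linear_combination -((2 - α) * Theta T t) * h
  have h₂ := pd_comp_coord (x := x) n n ((hasDerivAt_id (x n)).const_mul (-((2 - α) * Theta T t)))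
  simp only [id, Pi.single_eq_same, mul_one] at h₂
  rw [divA, h₀, zero_add, ← h₂]
  exact congrArg (fun L : (Fin N → ℝ) →L[ℝ] ℝ => L (Pi.single n 1)) h₁.fderiv_eq

lemma contDiff_coord_rpow {N : ℕ} (n : Fin N) {p : ℝ} (hp : 1 ≤ p) :
    ContDiff ℝ 1 (fun x : Fin N → ℝ => x n ^ p) :=
  (Real.contDiff_rpow_const_of_le (n := 1) (by simpa using hp)).comp (contDiff_apply ℝ ℝ n)

lemma integral_pd_sq_mul_rpow {N : ℕ} (n : Fin N) {p : ℝ} (hp : 1 ≤ p)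
    {u : (Fin N → ℝ) → ℝ} (hu : ContDiff ℝ 1 u) (huc : HasCompactSupport u) :
    Integrable (fun x => 2 * u x * pd n u x * x n ^ p) ∧
    Integrable (fun x => u x ^ 2 * (p * x n ^ (p - 1))) ∧
    ∫ x, 2 * u x * pd n u x * x n ^ p = -∫ x, u x ^ 2 * (p * x n ^ (p - 1)) := by
  have hw := contDiff_coord_rpow n hp
  have hpw (x : Fin N → ℝ) :
      fderiv ℝ (fun x : Fin N → ℝ => x n ^ p) x (Pi.single n 1) = p * x n ^ (p - 1) := by
    have h := pd_comp_coord (x := x) n n (Real.hasDerivAt_rpow_const (Or.inr hp))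
    simpa [pd] using h
  have hpu (x : Fin N → ℝ) :
      fderiv ℝ (fun x => u x ^ 2) x (Pi.single n 1) = 2 * u x * pd n u x := by
    have h := ((hu.differentiable one_ne_zero x).hasFDerivAt.pow 2).fderiv
    rw [h]
    simp [pd]
  have hsq : ContDiff ℝ 1 (fun x => u x ^ 2) := hu.pow 2
  have hdu : Continuous (pd n u) := (hu.continuous_fderiv one_ne_zero).clm_apply continuous_const
  have hi₁ : Integrable (fun x => 2 * u x * pd n u x * x n ^ p) :=
    (((continuous_const.mul hu.continuous).mul hdu).mul
      hw.continuous).integrable_of_hasCompactSupport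
        ((huc.mul_left (f := fun _ => (2 : ℝ))).mul_right.mul_right)
  have huc2 : HasCompactSupport (fun x => u x ^ 2) := by
    simp only [sq]
    exact huc.mul_right
  have hcp : Continuous (fun x : Fin N → ℝ => x n ^ (p - 1)) :=
    (continuous_apply n).rpow_const fun _ => Or.inr (by linarith)
  have hi₂ : Integrable (fun x => u x ^ 2 * (p * x n ^ (p - 1))) :=
    (hsq.continuous.mul (continuous_const.mul hcp)).integrable_of_hasCompactSupport huc2.mul_right
  have hi₃ : Integrable (fun x => u x ^ 2 * x n ^ p) :=
    (hsq.continuous.mul hw.continuous).integrable_of_hasCompactSupport huc2.mul_right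
  refine ⟨hi₁, hi₂, ?_⟩
  have h := integral_mul_fderiv_eq_neg_fderiv_mul_of_integrable (𝕜 := ℝ) (μ := volume)
    (f := fun x => u x ^ 2) (g := fun x : Fin N → ℝ => x n ^ p) (v := Pi.single n 1)
    (by simpa only [hpu] using hi₁) (by simpa only [hpw] using hi₂) hi₃
    (fun x _ => hsq.differentiable one_ne_zero x) (fun x _ => hw.differentiable one_ne_zero x)
  simp only [hpu, hpw] at h
  rw [h, neg_neg]

lemma integral_carleman_pairing {N : ℕ} (n : Fin N) {α : ℝ} (hα : α ≤ 1) (T γ s t : ℝ)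
    {Ω : Set (Fin N → ℝ)} (hΩ : MeasurableSet Ω) (hΩs : Ω ⊆ {x | 0 < x n})
    {u : (Fin N → ℝ) → ℝ} (hu : ContDiff ℝ 1 u) (huc : HasCompactSupport u)
    (huΩ : ∀ x ∉ Ω, u x = 0) :
    ∫ x in Ω, (2 * s * agrad α n u (fun x' => xi n α T γ x' t) x
          + s * u x * divA α n (fun x' => xi n α T γ x' t) x)
        * (s ^ 2 * u x *
            agrad α n (fun x' => xi n α T γ x' t) (fun x' => xi n α T γ x' t) x)
      = (2 - α) ^ 4 * s ^ 3 * ∫ x in Ω, Theta T t ^ 3 * u x ^ 2 * x n ^ (2 - α) := by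
  obtain ⟨hi₁, hi₂, hibp⟩ := integral_pd_sq_mul_rpow n (p := 3 - α) (by linarith) hu huc
  have hp : 3 - α ≠ 0 := by linarith
  rw [show 3 - α - 1 = 2 - α by ring] at hi₂ hibp
  have hcongr : ∀ x ∈ Ω, (2 * s * agrad α n u (fun x' => xi n α T γ x' t) x
          + s * u x * divA α n (fun x' => xi n α T γ x' t) x)
        * (s ^ 2 * u x *
            agrad α n (fun x' => xi n α T γ x' t) (fun x' => xi n α T γ x' t) x)
      = -((2 - α) * s * Theta T t) ^ 3 * (2 * u x * pd n u x * x n ^ (3 - α)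
          + (3 - α)⁻¹ * (u x ^ 2 * ((3 - α) * x n ^ (2 - α)))) := by
    intro x hx
    have hx' : 0 < x n := hΩs hx
    have h : x n ^ (3 - α) = x n * x n ^ (2 - α) := by
      rw [show 3 - α = 1 + (2 - α) by ring, Real.rpow_add hx', Real.rpow_one]
    rw [agrad_xi_right n hα T γ t u hx', divA_xi n hα T γ t hx', agrad_xi_xi n hα T γ t hx', h]
    linear_combination -((2 - α) * s * Theta T t) ^ 3 * (u x ^ 2 * x n ^ (2 - α)) *
      (-inv_mul_cancel₀ hp)
  have hrhs : ∀ x, Theta T t ^ 3 * u x ^ 2 * x n ^ (2 - α) =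
      (Theta T t ^ 3 * (3 - α)⁻¹) * (u x ^ 2 * ((3 - α) * x n ^ (2 - α))) := by
    intro x
    linear_combination -(Theta T t ^ 3 * u x ^ 2 * x n ^ (2 - α)) * inv_mul_cancel₀ hp
  rw [setIntegral_congr_fun hΩ hcongr,
    setIntegral_eq_integral_of_forall_compl_eq_zero (fun x hx => by simp [huΩ x hx]),
    setIntegral_eq_integral_of_forall_compl_eq_zero (fun x hx => by simp [huΩ x hx])]
  simp only [hrhs]
  rw [integral_const_mul, integral_const_mul, integral_add hi₁ (hi₂.const_mul _),
    integral_const_mul, hibp]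
  linear_combination -((2 - α) * s * Theta T t) ^ 3 *
    (∫ x, u x ^ 2 * ((3 - α) * x n ^ (2 - α))) * inv_mul_cancel₀ hp

/-- Step d) of the Carleman computation: the pairing `(P₁₂z + P₁₃z, P₂₃z)`
(compact-support case). -/
theorem carleman_step_d
    (N : ℕ) (hN : 2 ≤ N) (n : Fin N) (hn : (n : ℕ) = N - 1)
    (α T γ s : ℝ) (hα : α ∈ Ioo (0 : ℝ) 1) (hT : 0 < T) (hs : 0 < s)
    (Ω : Set (Fin N → ℝ)) (hΩo : IsOpen Ω) (hΩb : Bornology.IsBounded Ω)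
    (hΩs : Ω ⊆ {x | 0 < x n})
    (z : (Fin N → ℝ) → ℝ → ℝ)
    (hz : ContDiff ℝ (⊤ : ℕ∞) (fun p : (Fin N → ℝ) × ℝ => z p.1 p.2))
    (hcs : HasCompactSupport (fun p : (Fin N → ℝ) × ℝ => z p.1 p.2))
    (hsupp : tsupport (fun p : (Fin N → ℝ) × ℝ => z p.1 p.2) ⊆ Ω ×ˢ Ioo (0 : ℝ) T) :
    ∫ t in Ioo (0 : ℝ) T, ∫ x in Ω,
        (2 * s * agrad α n (fun x' => z x' t) (fun x' => xi n α T γ x' t) x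
            + s * z x t * divA α n (fun x' => xi n α T γ x' t) x)
          * (s ^ 2 * z x t *
              agrad α n (fun x' => xi n α T γ x' t) (fun x' => xi n α T γ x' t) x)
      = (2 - α) ^ 4 * s ^ 3 * (∫ t in Ioo (0 : ℝ) T, ∫ x in Ω,
          (Theta T t) ^ 3 * (z x t) ^ 2 * x n ^ (2 - α)) := by
  rw [← integral_const_mul]
  refine integral_congr_ae (.of_forall fun t => ?_)
  have hmem : ∀ x, z x t ≠ 0 → (x, t) ∈ tsupport (fun p : (Fin N → ℝ) × ℝ => z p.1 p.2) :=
    fun x hx => subset_tsupport _ hx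
  refine integral_carleman_pairing n hα.2.le T γ s t hΩo.measurableSet hΩs ?_ ?_ ?_
  · exact (hz.of_le (by exact_mod_cast le_top)).comp (contDiff_prodMk_left t)
  · refine HasCompactSupport.intro (hcs.isCompact.image continuous_fst) fun x hx => ?_
    by_contra h
    exact hx ⟨(x, t), hmem x h, rfl⟩
  · intro x hx
    by_contra h
    exact hx (hsupp (hmem x h)).1
end
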